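/- Let k be an infinite field and Γ a finite graph. The invariant subring A(Γ)^{T_Γ} is a free k-module with basis {M^c : c ∈ H₁(Γ,ℤ)}, where for c ∈ H₁(Γ,ℤ) written in its canonical nonnegative form c = Σ_{e⃗} a(e⃗)·e⃗ (with a(e⃗) ∈ ℕ and a(e⃗)·a(ι(e⃗)) = 0 for every edge) one sets M^c := ∏_{e⃗} U_{e⃗}^{a(e⃗)} ∈ A(Γ); moreover the multiplication satisfies M^c · M^{c'} = M^{c+c'} if (c,e⃗)·(c',e⃗) ≥ 0 for every e⃗ ∈ E⃗, and M^c · M^{c'} = 0 otherwise. (Thus A(Γ)^{T_Γ} is isomorphic to the cographic toric face ring R(Γ).) -/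

import Mathlib

/-!
Serre-style finite graphs: a vertex type `V`, an oriented-edge type `E` with a
fixed-point-free involution `inv` (edge reversal) and source/target maps `s, t`
with `s (inv e) = t e`.  An unoriented edge is an `inv`-orbit `{e, inv e}`;
subsets of unoriented edges are encoded as `inv`-closed subsets of `E`, and an
orientation of a spanning subgraph `Γ∖T` is encoded by the set `O` of its
positively oriented edges.  1-chains with coefficients in `A` are encoded as
functions `c : E → A` with `c (inv e) = - c e` (so that `(c, e⃗) = c e` for the
standard bilinear form).
-/

structure SerreGraph where
  V : Type
  E : Type
  [fintypeV : Fintype V]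
  [fintypeE : Fintype E]
  [decEqV : DecidableEq V]
  [decEqE : DecidableEq E]
  inv : E → E
  s : E → V
  t : E → V
  inv_inv : ∀ e, inv (inv e) = e
  inv_ne : ∀ e, inv e ≠ e
  s_inv : ∀ e, s (inv e) = t e

attribute [instance] SerreGraph.fintypeV SerreGraph.fintypeE
attribute [instance] SerreGraph.decEqV SerreGraph.decEqE

namespace SerreGraph

variable (Γ : SerreGraph)

/-- Reachability between vertices in the spanning subgraph whose allowed oriented
edges are those in `A`. -/
def Reach (A : Set Γ.E) : Γ.V → Γ.V → Prop :=
  Relation.ReflTransGen (fun a b => ∃ e ∈ A, Γ.s e = a ∧ Γ.t e = b)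

/-- The number of connected components of the spanning subgraph with allowed
oriented edges `A`. -/
noncomputable def numComponents (A : Set Γ.E) : ℕ :=
  Nat.card (Quot (fun a b : Γ.V => ∃ e ∈ A, Γ.s e = a ∧ Γ.t e = b))

/-- The set of separating (oriented) edges: removing the underlying unoriented
edge increases the number of connected components. -/
def Esep : Set Γ.E :=
  {e | Γ.numComponents Set.univ < Γ.numComponents {f | f ≠ e ∧ f ≠ Γ.inv e}}

/-- `T` encodes a set of unoriented edges. -/
def InvClosed (T : Set Γ.E) : Prop := ∀ e, e ∈ T ↔ Γ.inv e ∈ T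

/-- `O` is (the set of positively oriented edges of) an orientation of `Γ∖T`. -/
def IsOrientation (T O : Set Γ.E) : Prop :=
  (∀ e ∈ O, e ∉ T) ∧ ∀ e, e ∉ T → (e ∈ O ↔ Γ.inv e ∉ O)

/-- A totally cyclic orientation of `Γ∖T`: an orientation such that there is no
vertex set `W` which is nonempty and proper inside some connected component of
`Γ∖T` and such that all edges of `Γ∖T` crossing the boundary of `W` are oriented
out of `W` (this is the componentwise condition of the paper). -/
def IsTotallyCyclic (T O : Set Γ.E) : Prop :=
  Γ.IsOrientation T O ∧
    ¬ ∃ W : Set Γ.V, (∃ v ∈ W, ∃ w ∈ Wᶜ, Γ.Reach Tᶜ v w) ∧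
        ∀ e ∈ O, Γ.t e ∈ W → Γ.s e ∈ W

/-- `γ` is (the set of positively oriented edges of) an oriented circuit of `Γ`:
a cyclic subgraph (connected, first Betti number one, no separating edges)
together with a totally cyclic orientation; equivalently a directed cycle:
each incident vertex has exactly one outgoing and one incoming edge in `γ`,
and the support is connected. -/
def IsCircuit (γ : Finset Γ.E) : Prop :=
  γ.Nonempty ∧ (∀ e ∈ γ, Γ.inv e ∉ γ) ∧
    (∀ v ∈ γ.image Γ.s ∪ γ.image Γ.t, ∃! e, e ∈ γ ∧ Γ.s e = v) ∧
    (∀ v ∈ γ.image Γ.s ∪ γ.image Γ.t, ∃! e, e ∈ γ ∧ Γ.t e = v) ∧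
    ∀ e ∈ γ, ∀ f ∈ γ, Γ.Reach ((↑γ : Set Γ.E) ∪ Γ.inv '' ↑γ) (Γ.s e) (Γ.s f)

/-- The class `[γ] ∈ H₁(Γ,ℤ)` of an oriented circuit. -/
def circChainZ (γ : Finset Γ.E) : Γ.E → ℤ :=
  fun e => if e ∈ γ then 1 else if Γ.inv e ∈ γ then -1 else 0

/-- The class `[γ] ∈ H₁(Γ,ℝ)` of an oriented circuit. -/
noncomputable def circChainR (γ : Finset Γ.E) : Γ.E → ℝ :=
  fun e => (Γ.circChainZ γ e : ℝ)

/-- `Cir_φ(Γ∖T)`: oriented circuits of `Γ∖T` compatibly oriented with the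
orientation with positive edges `O`. -/
def Cir (T O : Set Γ.E) : Set (Finset Γ.E) :=
  {γ | Γ.IsCircuit γ ∧ (∀ e ∈ γ, e ∈ O) ∧ ∀ e ∈ γ, e ∉ T}

/-- `c` is a 1-cycle: a skew 1-chain with vanishing boundary, i.e. an element of
`H₁(Γ,A)`. -/
def IsCycle {A : Type*} [AddCommGroup A] (c : Γ.E → A) : Prop :=
  (∀ e, c (Γ.inv e) = - c e) ∧
    ∀ v, ∑ e ∈ Finset.univ.filter (fun e => Γ.t e = v), c e = 0

/-- An element of `H₁(Γ∖T, A) ⊆ H₁(Γ,A)`: a cycle supported on edges not in `T`. -/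
def IsCycleOn {A : Type*} [AddCommGroup A] (T : Set Γ.E) (c : Γ.E → A) : Prop :=
  Γ.IsCycle c ∧ ∀ e ∈ T, c e = 0

/-- The standard positive definite bilinear form on `C⃗₁(Γ,ℝ)`, for which
`(c, e⃗) = c e`. -/
noncomputable def pair (c c' : Γ.E → ℝ) : ℝ := (∑ e, c e * c' e) / 2

/-- The first Betti number `b₁(Γ) = dim_ℝ H₁(Γ,ℝ)`. -/
noncomputable def b1 : ℕ :=
  Module.finrank ℝ (Submodule.span ℝ {c : Γ.E → ℝ | Γ.IsCycle c})

/-- `b₁(Γ∖T) = dim_ℝ H₁(Γ∖T,ℝ)`. -/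
noncomputable def b1Sub (T : Set Γ.E) : ℕ :=
  Module.finrank ℝ (Submodule.span ℝ {c : Γ.E → ℝ | Γ.IsCycleOn T c})

/-- The cone `σ(T,φ) ⊆ H₁(Γ,ℝ)` of the cographic fan associated to a pair
`(T, O)` with `O` an orientation of `Γ∖T`. -/
def sigmaCone (T O : Set Γ.E) : Set (Γ.E → ℝ) :=
  {v | Γ.IsCycle v ∧ (∀ e ∈ O, 0 ≤ v e) ∧ ∀ e ∈ T, v e = 0}

/-- The poset `OP_Γ` of totally cyclic orientations: pairs `(T, O)` with `T` a
set of unoriented edges and `O` a totally cyclic orientation of `Γ∖T`. -/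
def OP : Set (Set Γ.E × Set Γ.E) :=
  {p | Γ.InvClosed p.1 ∧ Γ.IsTotallyCyclic p.1 p.2}

/-- The order on `OP_Γ`: `(T',φ') ≤ (T,φ)` iff `T' ⊇ T` and `φ'` is the
restriction of `φ`. -/
def OPle (p q : Set Γ.E × Set Γ.E) : Prop :=
  q.1 ⊆ p.1 ∧ p.2 = q.2 ∩ p.1ᶜ

/-- `H₁(Γ,ℤ)` viewed as the set of lattice points of `H₁(Γ,ℝ)`. -/
def H1Z : Set (Γ.E → ℝ) := {c | Γ.IsCycle c ∧ ∀ e, ∃ n : ℤ, c e = (n : ℝ)}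

/-- The Voronoi polytope `Vor_Γ ⊆ H₁(Γ,ℝ)`. -/
def voronoi : Set (Γ.E → ℝ) :=
  {v | Γ.IsCycle v ∧ ∀ l ∈ Γ.H1Z, Γ.pair v v ≤ Γ.pair (v - l) (v - l)}

/-- A (exposed) face of the Voronoi polytope. -/
def IsVorFace (F : Set (Γ.E → ℝ)) : Prop :=
  ∃ l : (Γ.E → ℝ) →ₗ[ℝ] ℝ, F = {v | v ∈ Γ.voronoi ∧ ∀ w ∈ Γ.voronoi, l w ≤ l v}

/-- The face `F(T,φ)` of the Voronoi polytope associated to `(T,O) ∈ OP_Γ`. -/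
def vorFace (T O : Set Γ.E) : Set (Γ.E → ℝ) :=
  {v | v ∈ Γ.voronoi ∧ ∀ γ ∈ Γ.Cir T O,
      Γ.pair v (Γ.circChainR γ) = Γ.pair (Γ.circChainR γ) (Γ.circChainR γ) / 2}

end SerreGraph

namespace SerreGraph

open MvPolynomial

variable (Γ : SerreGraph)

/-- The ideal `(U_{e⃗}·U_{ι(e⃗)} : e ∈ E)` of the polynomial ring `k[U_{e⃗}]`. -/
noncomputable def relIdeal (k : Type*) [CommRing k] : Ideal (MvPolynomial Γ.E k) :=
  Ideal.span {q | ∃ e : Γ.E, q = X e * X (Γ.inv e)}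

/-- The ring `A(Γ) = k[U_{e⃗} : e⃗ ∈ E⃗]/(U_{e⃗}·U_{ι(e⃗)})`. -/
abbrev Aring (k : Type*) [CommRing k] := MvPolynomial Γ.E k ⧸ Γ.relIdeal k

/-- The action of `λ ∈ T_Γ = (kˣ)^V` on `A(Γ)`, determined by
`U_{e⃗} ↦ λ_{s(e⃗)} λ_{t(e⃗)}⁻¹ U_{e⃗}`. -/
noncomputable def torusAct (k : Type*) [CommRing k] (lam : Γ.V → kˣ) :
    Γ.Aring k →ₐ[k] Γ.Aring k :=
  Ideal.Quotient.liftₐ (Γ.relIdeal k)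
    ((Ideal.Quotient.mkₐ k (Γ.relIdeal k)).comp
      (MvPolynomial.aeval
        (fun e => C ((lam (Γ.s e) : k) * ((lam (Γ.t e))⁻¹ : kˣ)) * X e)))
    (by
      intro a ha
      simp only [AlgHom.comp_apply, Ideal.Quotient.mkₐ_eq_mk]
      rw [Ideal.Quotient.eq_zero_iff_mem]
      have h : Γ.relIdeal k ≤
          Ideal.comap (MvPolynomial.aeval
            (fun e => C ((lam (Γ.s e) : k) * ((lam (Γ.t e))⁻¹ : kˣ)) * X e) :
              MvPolynomial Γ.E k →ₐ[k] MvPolynomial Γ.E k).toRingHom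
            (Γ.relIdeal k) := by
        rw [relIdeal, Ideal.span_le]
        rintro q ⟨e, rfl⟩
        simp only [SetLike.mem_coe, Ideal.mem_comap, AlgHom.toRingHom_eq_coe,
          RingHom.coe_coe, map_mul, aeval_X]
        have hmem : (X e * X (Γ.inv e) : MvPolynomial Γ.E k) ∈ Γ.relIdeal k :=
          Ideal.subset_span ⟨e, rfl⟩
        have h2 : (C ((lam (Γ.s e) : k)) * C (((lam (Γ.t e))⁻¹ : kˣ) : k) *
            (C ((lam (Γ.s (Γ.inv e)) : k)) * C (((lam (Γ.t (Γ.inv e)))⁻¹ : kˣ) : k))) *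
            (X e * X (Γ.inv e)) ∈ Γ.relIdeal k :=
          Ideal.mul_mem_left _ _ hmem
        rw [relIdeal] at h2
        convert h2 using 1
        ring
      exact h ha)

/-- The invariant subring `A(Γ)^{T_Γ}`. -/
noncomputable def invariants (k : Type*) [CommRing k] : Subalgebra k (Γ.Aring k) :=
  ⨅ lam : Γ.V → kˣ, AlgHom.equalizer (Γ.torusAct k lam) (AlgHom.id k (Γ.Aring k))

/-- The monomial `M^c = ∏ U_{e⃗}^{max(c(e⃗),0)} ∈ A(Γ)` attached to a skew chain
`c`, using its canonical nonnegative form. -/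
noncomputable def Mon (k : Type*) [CommRing k] (c : Γ.E → ℤ) : Γ.Aring k :=
  Ideal.Quotient.mk (Γ.relIdeal k) (∏ e, X e ^ (c e).toNat)

end SerreGraph


namespace SerreGraph

open MvPolynomial

variable (Γ : SerreGraph)

/-- An exponent vector whose monomial involves no edge together with its reversal. -/
def IsReduced (m : Γ.E →₀ ℕ) : Prop := ∀ e, m e = 0 ∨ m (Γ.inv e) = 0

/-- The exponent vector of the canonical nonnegative form of a chain. -/
noncomputable def posPart (c : Γ.E → ℤ) : Γ.E →₀ ℕ :=
  Finsupp.equivFunOnFinite.symm fun e => (c e).toNat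

/-- The skew chain `∑ m(e⃗)·e⃗` of an exponent vector. -/
def chainOf (m : Γ.E →₀ ℕ) : Γ.E → ℤ := fun e => m e - m (Γ.inv e)

/-- The character of the torus by which it acts on the monomial of an exponent vector. -/
def weight {G : Type*} [CommGroup G] (lam : Γ.V → G) (m : Γ.E →₀ ℕ) : G :=
  ∏ e, (lam (Γ.s e) * (lam (Γ.t e))⁻¹) ^ m e

@[simp]
lemma posPart_apply (c : Γ.E → ℤ) (e : Γ.E) : Γ.posPart c e = (c e).toNat := rfl

lemma t_inv (e : Γ.E) : Γ.s e = Γ.t (Γ.inv e) := by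
  rw [← Γ.s_inv, Γ.inv_inv]

lemma inv_involutive : Function.Involutive Γ.inv := Γ.inv_inv

variable {Γ}

lemma isReduced_posPart {c : Γ.E → ℤ} (hc : ∀ e, c (Γ.inv e) = -c e) :
    Γ.IsReduced (Γ.posPart c) := by
  intro e
  simp only [posPart_apply, hc]
  omega

lemma chainOf_posPart {c : Γ.E → ℤ} (hc : ∀ e, c (Γ.inv e) = -c e) :
    Γ.chainOf (Γ.posPart c) = c := by
  funext e
  simp only [chainOf, posPart_apply, hc]
  omega

lemma posPart_chainOf {m : Γ.E →₀ ℕ} (hm : Γ.IsReduced m) :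
    Γ.posPart (Γ.chainOf m) = m := by
  ext e
  have := hm e
  simp only [chainOf, posPart_apply]
  omega

lemma chainOf_inv (m : Γ.E →₀ ℕ) (e : Γ.E) : Γ.chainOf m (Γ.inv e) = -Γ.chainOf m e := by
  simp only [chainOf, Γ.inv_inv]
  ring

lemma weight_eq {G : Type*} [CommGroup G] (lam : Γ.V → G) (m : Γ.E →₀ ℕ) :
    Γ.weight lam m =
      ∏ v, lam v ^ (-∑ e ∈ Finset.univ.filter (fun e => Γ.t e = v), Γ.chainOf m e) := by
  have hs : ∏ e, lam (Γ.s e) ^ m e = ∏ e, lam (Γ.t e) ^ m (Γ.inv e) := by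
    refine Fintype.prod_equiv Γ.inv_involutive.toPerm _ _ fun e => ?_
    simp [Γ.inv_inv, Γ.t_inv e]
  have h : Γ.weight lam m = ∏ e, lam (Γ.t e) ^ (-Γ.chainOf m e) := by
    simp only [weight, mul_pow, Finset.prod_mul_distrib, hs]
    rw [← Finset.prod_mul_distrib]
    refine Finset.prod_congr rfl fun e _ => ?_
    simp only [chainOf, neg_sub, zpow_sub, zpow_natCast, inv_pow]
  rw [h, ← Finset.prod_fiberwise Finset.univ Γ.t]
  refine Finset.prod_congr rfl fun v _ => ?_
  have hsum (f : Γ.E → ℤ) (S : Finset Γ.E) : lam v ^ (∑ e ∈ S, f e) = ∏ e ∈ S, lam v ^ f e :=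
    congrArg Additive.toMul (Finset.sum_smul (f := f) (s := S) (x := Additive.ofMul (lam v)))
  rw [← Finset.sum_neg_distrib, hsum]
  refine Finset.prod_congr rfl fun e he => ?_
  rw [(Finset.mem_filter.1 he).2]

lemma weight_eq_one {G : Type*} [CommGroup G] (lam : Γ.V → G) {m : Γ.E →₀ ℕ}
    (hm : Γ.IsCycle (Γ.chainOf m)) : Γ.weight lam m = 1 := by
  rw [weight_eq]
  exact Finset.prod_eq_one fun v _ => by rw [hm.2 v, neg_zero, zpow_zero]

lemma _root_.Units.eq_zero_of_forall_zpow_eq_one {k : Type*} [Field k] [Infinite k] {n : ℤ}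
    (h : ∀ u : kˣ, u ^ n = 1) : n = 0 := by
  by_contra hn
  have : NeZero n.natAbs := ⟨Int.natAbs_ne_zero.2 hn⟩
  have hu (u : kˣ) : u ∈ rootsOfUnity n.natAbs k := by
    rw [mem_rootsOfUnity]
    exact pow_natAbs_eq_one.2 (h u)
  have : Finite kˣ := Finite.of_injective
    (fun u : kˣ => (⟨u, hu u⟩ : rootsOfUnity n.natAbs k)) fun u v huv => by simpa using huv
  have : Infinite ({0}ᶜ : Set k) := (Set.finite_singleton 0).infinite_compl.to_subtype
  have : Infinite kˣ := Infinite.of_injective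
    (fun x : ({0}ᶜ : Set k) => Units.mk0 x.1 x.2) fun x y hxy =>
      Subtype.ext (congrArg Units.val hxy)
  exact not_finite kˣ

lemma isCycle_of_weight_eq_one {k : Type*} [Field k] [Infinite k] {m : Γ.E →₀ ℕ}
    (h : ∀ lam : Γ.V → kˣ, Γ.weight lam m = 1) : Γ.IsCycle (Γ.chainOf m) := by
  refine ⟨chainOf_inv m, fun v => neg_eq_zero.1 ?_⟩
  refine Units.eq_zero_of_forall_zpow_eq_one (k := k) fun u => ?_
  have hu := h (Pi.mulSingle v u)
  rwa [weight_eq, Fintype.prod_eq_single v, Pi.mulSingle_eq_same] at hu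
  intro w hw
  rw [Pi.mulSingle_eq_of_ne hw, one_zpow]

section Ring

variable {k : Type*} [CommRing k]

lemma relIdeal_eq_span_monomial :
    Γ.relIdeal k = Ideal.span ((fun m => monomial m (1 : k)) ''
      Set.range fun e : Γ.E => Finsupp.single e 1 + Finsupp.single (Γ.inv e) 1) := by
  rw [relIdeal]
  congr 1
  ext q
  simp only [Set.mem_ofPred_eq, Set.mem_image, Set.mem_range, exists_exists_eq_and, X,
    monomial_mul, mul_one]
  exact exists_congr fun e => eq_comm

lemma single_add_single_le_iff {m : Γ.E →₀ ℕ} {e : Γ.E} :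
    Finsupp.single e 1 + Finsupp.single (Γ.inv e) 1 ≤ m ↔ m e ≠ 0 ∧ m (Γ.inv e) ≠ 0 := by
  have hne := Γ.inv_ne e
  constructor
  · intro h
    have h1 := h e
    have h2 := h (Γ.inv e)
    simp [hne, hne.symm] at h1 h2
    omega
  · rintro ⟨h1, h2⟩ f
    simp only [Finsupp.add_apply, Finsupp.single_apply]
    split_ifs with h3 h4 h4
    · exact absurd (h4.trans h3.symm) hne
    · subst h3; omega
    · subst h4; omega
    · omega

lemma mem_relIdeal_iff {p : MvPolynomial Γ.E k} :
    p ∈ Γ.relIdeal k ↔ ∀ m ∈ p.support, ¬ Γ.IsReduced m := by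
  rw [relIdeal_eq_span_monomial, mem_ideal_span_monomial_image]
  simp only [Set.mem_range, exists_exists_eq_and, single_add_single_le_iff, IsReduced,
    not_forall, not_or, ne_eq]

lemma mk_monomial_eq_zero {m : Γ.E →₀ ℕ} (hm : ¬ Γ.IsReduced m) (r : k) :
    Ideal.Quotient.mk (Γ.relIdeal k) (monomial m r) = 0 := by
  rw [Ideal.Quotient.eq_zero_iff_mem, mem_relIdeal_iff]
  intro n hn
  rwa [Finset.mem_singleton.1 (support_monomial_subset hn)]

/-- The coefficient of a reduced monomial, as a linear form on `A(Γ)`. -/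
noncomputable def redCoeff (k : Type*) [CommRing k] {m : Γ.E →₀ ℕ} (hm : Γ.IsReduced m) :
    Γ.Aring k →ₗ[k] k :=
  Submodule.liftQ ((Γ.relIdeal k).restrictScalars k) (lcoeff k m) fun p hp => by
    by_contra h
    exact mem_relIdeal_iff.1 hp m (mem_support_iff.2 h) hm

@[simp]
lemma redCoeff_mk {m : Γ.E →₀ ℕ} (hm : Γ.IsReduced m) (p : MvPolynomial Γ.E k) :
    redCoeff k hm (Ideal.Quotient.mk (Γ.relIdeal k) p) = coeff m p := rfl

lemma Mon_eq (c : Γ.E → ℤ) :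
    Γ.Mon k c = Ideal.Quotient.mk (Γ.relIdeal k) (monomial (Γ.posPart c) 1) := by
  rw [Mon, monomial_eq, C_1, one_mul, Finsupp.prod_fintype _ _ fun e => pow_zero _]
  rfl

lemma torusAct_mk_monomial (lam : Γ.V → kˣ) (m : Γ.E →₀ ℕ) (r : k) :
    Γ.torusAct k lam (Ideal.Quotient.mk (Γ.relIdeal k) (monomial m r)) =
      Ideal.Quotient.mk (Γ.relIdeal k) (monomial m (((Γ.weight lam m : kˣ) : k) * r)) := by
  have h : Γ.torusAct k lam (Ideal.Quotient.mk (Γ.relIdeal k) (monomial m r)) =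
      Ideal.Quotient.mk (Γ.relIdeal k) (aeval (fun e =>
        C ((lam (Γ.s e) : k) * ((lam (Γ.t e))⁻¹ : kˣ)) * X e) (monomial m r)) := rfl
  rw [h]
  congr 1
  rw [aeval_monomial, monomial_eq (s := m), Finsupp.prod_fintype _ _ fun e => pow_zero _,
    Finsupp.prod_fintype _ _ fun e => pow_zero _]
  simp only [mul_pow, Finset.prod_mul_distrib, weight, Units.coe_prod, Units.val_pow_eq_pow_val,
    Units.val_mul, map_mul, map_prod, map_pow, algebraMap_eq]
  ring

lemma redCoeff_torusAct {m : Γ.E →₀ ℕ} (hm : Γ.IsReduced m) (lam : Γ.V → kˣ)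
    (p : MvPolynomial Γ.E k) :
    redCoeff k hm (Γ.torusAct k lam (Ideal.Quotient.mk (Γ.relIdeal k) p)) =
      ((Γ.weight lam m : kˣ) : k) * coeff m p := by
  induction p using MvPolynomial.induction_on' with
  | monomial n r =>
    rw [torusAct_mk_monomial, redCoeff_mk, coeff_monomial, coeff_monomial]
    split_ifs with h
    · rw [h]
    · rw [mul_zero]
  | add p q hp hq => rw [map_add, map_add, map_add, hp, hq, coeff_add, mul_add]

lemma mem_invariants_iff {x : Γ.Aring k} :
    x ∈ Γ.invariants k ↔ ∀ lam, Γ.torusAct k lam x = x := by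
  simp only [invariants, Algebra.mem_iInf, AlgHom.mem_equalizer, AlgHom.id_apply]

lemma Mon_mem_invariants {c : Γ.E → ℤ} (hc : Γ.IsCycle c) : Γ.Mon k c ∈ Γ.invariants k := by
  refine mem_invariants_iff.2 fun lam => ?_
  rw [Mon_eq, torusAct_mk_monomial, weight_eq_one lam (by rwa [chainOf_posPart hc.1]),
    Units.val_one, one_mul]

lemma linearIndependent_Mon :
    LinearIndependent k (fun c : {c : Γ.E → ℤ // Γ.IsCycle c} => Γ.Mon k c.1) := by
  rw [linearIndependent_iff]
  intro f hf
  ext c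
  have hc := isReduced_posPart c.2.1
  have h := congrArg (redCoeff k hc) hf
  rw [map_zero, Finsupp.linearCombination_apply, map_finsuppSum, Finsupp.sum,
    Finset.sum_eq_single c] at h
  · simpa [Mon_eq] using h
  · intro d _ hd
    have hne : Γ.posPart d.1 ≠ Γ.posPart c.1 := fun he => hd <| Subtype.ext <| by
      rw [← chainOf_posPart d.2.1, he, chainOf_posPart c.2.1]
    simp [Mon_eq, coeff_monomial, hne]
  · intro hcf
    simp [Finsupp.notMem_support_iff.1 hcf]

lemma Mon_mul_Mon (c c' : Γ.E → ℤ) : Γ.Mon k c * Γ.Mon k c' =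
    Ideal.Quotient.mk (Γ.relIdeal k) (monomial (Γ.posPart c + Γ.posPart c') 1) := by
  rw [Mon_eq, Mon_eq, ← map_mul, monomial_mul, one_mul]

lemma Mon_mul_Mon_of_nonneg {c c' : Γ.E → ℤ} (h : ∀ e, 0 ≤ c e * c' e) :
    Γ.Mon k c * Γ.Mon k c' = Γ.Mon k (c + c') := by
  rw [Mon_mul_Mon, Mon_eq]
  have hadd : Γ.posPart c + Γ.posPart c' = Γ.posPart (c + c') := by
    ext e
    simp only [Finsupp.add_apply, posPart_apply, Pi.add_apply]
    rcases mul_nonneg_iff.1 (h e) with h | h <;> omega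
  rw [hadd]

lemma Mon_mul_Mon_of_not_nonneg {c c' : Γ.E → ℤ} (h : ¬ ∀ e, 0 ≤ c e * c' e)
    (hc : ∀ e, c (Γ.inv e) = -c e) (hc' : ∀ e, c' (Γ.inv e) = -c' e) :
    Γ.Mon k c * Γ.Mon k c' = 0 := by
  rw [Mon_mul_Mon]
  refine mk_monomial_eq_zero (fun hr => h fun e => ?_) 1
  have he := hr e
  simp only [Finsupp.add_apply, posPart_apply, hc, hc'] at he
  rcases he with he | he
  · exact mul_nonneg_of_nonpos_of_nonpos (by omega) (by omega)
  · exact mul_nonneg (by omega) (by omega)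

end Ring

lemma span_Mon {k : Type*} [Field k] [Infinite k] :
    Submodule.span k (Γ.Mon k '' {c | Γ.IsCycle c}) =
      Subalgebra.toSubmodule (Γ.invariants k) := by
  apply le_antisymm
  · rw [Submodule.span_le]
    rintro _ ⟨c, hc, rfl⟩
    exact Mon_mem_invariants hc
  · intro x hx
    obtain ⟨p, rfl⟩ := Ideal.Quotient.mk_surjective x
    have hinv := mem_invariants_iff.1 hx
    rw [p.as_sum, map_sum]
    refine Submodule.sum_mem _ fun m hmp => ?_
    by_cases hm : Γ.IsReduced m
    · have hcyc : Γ.IsCycle (Γ.chainOf m) := isCycle_of_weight_eq_one (k := k) fun lam => by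
        have h := congrArg (redCoeff k hm) (hinv lam)
        rw [redCoeff_torusAct, redCoeff_mk] at h
        exact Units.ext (mul_eq_right₀ (mem_support_iff.1 hmp) |>.1 h)
      have hmon : Ideal.Quotient.mk (Γ.relIdeal k) (monomial m (coeff m p)) =
          coeff m p • Γ.Mon k (Γ.chainOf m) := by
        rw [Mon_eq, posPart_chainOf hm, ← Ideal.Quotient.mkₐ_eq_mk k, ← map_smul,
          smul_monomial, smul_eq_mul, mul_one]
      rw [hmon]
      exact Submodule.smul_mem _ _ (Submodule.subset_span ⟨_, hcyc, rfl⟩)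
    · rw [mk_monomial_eq_zero hm]
      exact Submodule.zero_mem _

end SerreGraph

/-- Over an infinite field `k`, the invariant subring
`A(Γ)^{T_Γ}` is a free `k`-module with basis the monomials `M^c`, `c ∈ H₁(Γ,ℤ)`,
with multiplication `M^c · M^{c'} = M^{c+c'}` if `(c,e⃗)·(c',e⃗) ≥ 0` for all
`e⃗`, and `M^c · M^{c'} = 0` otherwise (so `A(Γ)^{T_Γ} ≅ R(Γ)`). -/
theorem stmt18 (k : Type*) [Field k] [Infinite k] (Γ : SerreGraph) :
    (∀ c : Γ.E → ℤ, Γ.IsCycle c → Γ.Mon k c ∈ Γ.invariants k) ∧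
    LinearIndependent k (fun c : {c : Γ.E → ℤ // Γ.IsCycle c} => Γ.Mon k c.1) ∧
    Submodule.span k (Γ.Mon k '' {c | Γ.IsCycle c}) =
      Subalgebra.toSubmodule (Γ.invariants k) ∧
    ∀ c c' : Γ.E → ℤ, Γ.IsCycle c → Γ.IsCycle c' →
      ((∀ e, 0 ≤ c e * c' e) → Γ.Mon k c * Γ.Mon k c' = Γ.Mon k (c + c')) ∧
      (¬ (∀ e, 0 ≤ c e * c' e) → Γ.Mon k c * Γ.Mon k c' = 0) := by
  exact ⟨fun c hc => SerreGraph.Mon_mem_invariants hc, SerreGraph.linearIndependent_Mon,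
    SerreGraph.span_Mon, fun c c' hc hc' =>
      ⟨fun h => SerreGraph.Mon_mul_Mon_of_nonneg h,
        fun h => SerreGraph.Mon_mul_Mon_of_not_nonneg h hc.1 hc'.1⟩⟩
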